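/- Let n be a positive integer, m = (m₁,…,m_n) a tuple of positive integers, and a ∈ C₀^∞(ℝⁿ). For each j fix a sign ±_j ∈ {+,−}, and for multi-indices α = (α₁,…,α_n) ∈ ℤ_{≥0}^n set c^{±_j}_{m_j,α_j} := m_j^{−1} [ e^{±_j iπ(α_j+1)/(2m_j)} + (−1)^{α_j} e^{±_j (−1)^{m_j} iπ(α_j+1)/(2m_j)} ] Γ((α_j+1)/m_j) and Ω_m^N := { α ∈ ℤ_{≥0}^n : Σ_{j=1}^n (α_j+1)/m_j < (N+1)/max_j m_j }. Then for every positive integer N, ∫_{ℝⁿ} e^{iλ Σ_{j=1}^n ±_j x_j^{m_j}} a(x) dx = Σ_{α ∈ Ω_m^N} ∏_{j=1}^n c^{±_j}_{m_j,α_j} · (∂^α a(0)/α!) · λ^{−Σ_{j=1}^n (α_j+1)/m_j} + O( λ^{−(N+1)/max_j m_j} ) as λ → ∞. -/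

import Mathlib

open MeasureTheory Filter Topology Set

/-- The partial derivative in the `j`-th coordinate direction. -/
noncomputable def pderiv {n : ℕ} (j : Fin n) (g : (Fin n → ℝ) → ℂ) : (Fin n → ℝ) → ℂ :=
  fun x => deriv (fun t : ℝ => g (Function.update x j t)) (x j)

/-- The iterated partial derivative `∂^α = ∂^{α 0}_{x 0} ⋯ ∂^{α (n-1)}_{x (n-1)}`. -/
noncomputable def multiDeriv {n : ℕ} (α : Fin n → ℕ) (g : (Fin n → ℝ) → ℂ) :
    (Fin n → ℝ) → ℂ :=
  ((List.finRange n).foldr (fun j G => (pderiv j)^[α j] ∘ G) id) g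

/-- A fixed even smooth cutoff function on `ℝ`, equal to `1` on `[-1, 1]` and `0` off `(-2, 2)`. -/
noncomputable def cutoff : ContDiffBump (0 : ℝ) := ⟨1, 2, one_pos, one_lt_two⟩

theorem cutoff_eq_one {t : ℝ} (ht : |t| ≤ 1) : cutoff t = 1 :=
  cutoff.one_of_mem_closedBall (by simpa [cutoff, Real.norm_eq_abs] using ht)

theorem cutoff_eq_zero {t : ℝ} (ht : 2 ≤ |t|) : cutoff t = 0 :=
  cutoff.zero_of_le_dist (by simpa [cutoff, Real.dist_eq] using ht)

theorem cutoff_eventuallyEq_one {t : ℝ} (ht : |t| < 1) : (cutoff : ℝ → ℝ) =ᶠ[𝓝 t] 1 :=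
  cutoff.eventuallyEq_one_of_mem_ball (by simpa [cutoff, Real.dist_eq] using ht)

/-- Rapid decay of the Laplace transform of a test function on the closed right half plane. -/
theorem exists_norm_laplace_le (L : ℕ) (g : ℝ → ℂ) (hg : ContDiff ℝ (⊤ : ℕ∞) g)
    (hc : HasCompactSupport g) (h0 : ∀ t < 0, g t = 0) :
    ∃ C, ∀ z : ℂ, 0 ≤ z.re → ‖z‖ ^ L * ‖∫ t : ℝ, Complex.exp (-z * t) * g t‖ ≤ C := by
  induction L generalizing g with
  | zero =>
    refine ⟨∫ t, ‖g t‖, fun z hz => ?_⟩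
    rw [pow_zero, one_mul]
    refine norm_integral_le_of_norm_le (hg.continuous.integrable_of_hasCompactSupport hc).norm
      (ae_of_all _ fun t => ?_)
    rcases lt_or_ge t 0 with ht | ht
    · simp [h0 t ht]
    · rw [norm_mul, Complex.norm_exp]
      refine mul_le_of_le_one_left (norm_nonneg _) (Real.exp_le_one_iff.2 ?_)
      simp only [neg_mul, Complex.neg_re, Complex.re_mul_ofReal]
      nlinarith
  | succ L ih =>
    obtain ⟨C, hC⟩ := ih (deriv g) (by fun_prop) hc.deriv fun t ht => by
      have : g =ᶠ[𝓝 t] fun _ => 0 := by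
        filter_upwards [Iio_mem_nhds ht] with x hx using h0 x hx
      rw [this.deriv_eq, deriv_const]
    refine ⟨C, fun z hz => ?_⟩
    have key : ∫ t : ℝ, Complex.exp (-z * t) * deriv g t =
        z * ∫ t : ℝ, Complex.exp (-z * t) * g t := by
      have hcont : Continuous fun t : ℝ => Complex.exp (-z * t) := by fun_prop
      have hdg : Continuous (deriv g) := hg.continuous_deriv (by simp)
      rw [integral_mul_deriv_eq_deriv_mul_of_integrable
        (u := fun t : ℝ => Complex.exp (-z * t)) (v := g)
        (u' := fun t : ℝ => Complex.exp (-z * t) * (-z)) (v' := deriv g),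
        ← integral_const_mul, ← integral_neg]
      · congr 1; ext t; ring
      · intro t _
        have : HasDerivAt (fun t : ℝ => -z * (t : ℂ)) (-z * 1) t :=
          (Complex.ofRealCLM.hasDerivAt (x := t)).const_mul (-z)
        simpa using this.cexp
      · exact fun t _ => ((hg.differentiable (by simp)) t).hasDerivAt
      · exact (hcont.mul hdg).integrable_of_hasCompactSupport hc.deriv.mul_left
      · exact ((hcont.mul continuous_const).mul hg.continuous).integrable_of_hasCompactSupport
          hc.mul_left
      · exact (hcont.mul hg.continuous).integrable_of_hasCompactSupport hc.mul_left
    have := hC z hz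
    rw [key, norm_mul, ← mul_assoc, ← pow_succ] at this
    exact this

theorem integrableOn_rpow_mul_cutoff {s : ℝ} (hs : 0 < s) :
    IntegrableOn (fun t : ℝ => t ^ (s - 1) * cutoff t) (Ioi 0) := by
  have h1 : IntegrableOn (fun t : ℝ => t ^ (s - 1) * cutoff t) (Ioc 0 2) := by
    have : IntegrableOn (fun t : ℝ => t ^ (s - 1)) (Ioc 0 2) :=
      (intervalIntegrable_iff_integrableOn_Ioc_of_le zero_le_two).1
        (intervalIntegral.intervalIntegrable_rpow' (by linarith))
    refine this.mul_bdd (c := 1) cutoff.continuous.aestronglyMeasurable (ae_of_all _ fun t => ?_)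
    rw [Real.norm_of_nonneg cutoff.nonneg]
    exact cutoff.le_one
  refine h1.of_forall_sdiff_eq_zero measurableSet_Ioi fun t ht => ?_
  have : 2 < t := by
    by_contra h
    exact ht.2 ⟨ht.1, not_lt.1 h⟩
  simp [cutoff_eq_zero (this.le.trans (le_abs_self t))]

/-- Multiplying a rotating exponential against an integrable weight preserves integrability. -/
theorem integrableOn_exp_mul_cutoff {s : ℝ} (hs : 0 < s) (z : ℂ) :
    IntegrableOn (fun t : ℝ => Complex.exp (-z * t) * ((t ^ (s - 1) * cutoff t : ℝ) : ℂ))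
      (Ioi 0) := by
  have h : IntegrableOn (fun t : ℝ => ((t ^ (s - 1) * cutoff t : ℝ) : ℂ)) (Ioi 0) :=
    (integrableOn_rpow_mul_cutoff hs).ofReal
  have hm : AEStronglyMeasurable
      (fun t : ℝ => Complex.exp (-z * t) * ((t ^ (s - 1) * cutoff t : ℝ) : ℂ))
      (volume.restrict (Ioi 0)) :=
    (by fun_prop : Continuous fun t : ℝ => Complex.exp (-z * t)).aestronglyMeasurable.mul
      h.aestronglyMeasurable
  refine (h.norm.const_mul (Real.exp (‖z‖ * 2))).mono' hm ?_
  refine (ae_restrict_iff' measurableSet_Ioi).2 (ae_of_all _ fun t (ht : 0 < t) => ?_)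
  rw [norm_mul]
  rcases le_total 2 |t| with h2 | h2
  · simp [cutoff_eq_zero h2]
  · refine mul_le_mul_of_nonneg_right ?_ (norm_nonneg _)
    rw [abs_of_pos ht] at h2
    refine (Complex.norm_exp_le_exp_norm _).trans (Real.exp_le_exp.2 ?_)
    rw [norm_mul, norm_neg, Complex.norm_real, Real.norm_of_nonneg ht.le]
    gcongr

/-- The Laplace transform of the truncated power `t ^ (s - 1)`. -/
noncomputable def truncLaplace (s : ℝ) (z : ℂ) : ℂ :=
  ∫ t in Ioi (0 : ℝ), Complex.exp (-z * t) * ((t ^ (s - 1) * cutoff t : ℝ) : ℂ)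

theorem hasDerivAt_truncLaplace {s : ℝ} (hs : 0 < s) (z : ℂ) :
    HasDerivAt (truncLaplace s) (-truncLaplace (s + 1) z) z := by
  have hi : IntegrableOn (fun t : ℝ => t ^ (s + 1 - 1) * cutoff t) (Ioi 0) :=
    integrableOn_rpow_mul_cutoff (by linarith)
  have key := (hasDerivAt_integral_of_dominated_loc_of_deriv_le
    (μ := volume.restrict (Ioi (0 : ℝ))) (x₀ := z) (s := Metric.ball z 1)
    (F := fun (z : ℂ) (t : ℝ) => Complex.exp (-z * t) * ((t ^ (s - 1) * cutoff t : ℝ) : ℂ))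
    (F' := fun (z : ℂ) (t : ℝ) =>
      -(Complex.exp (-z * t) * ((t ^ (s + 1 - 1) * cutoff t : ℝ) : ℂ)))
    (bound := fun t => Real.exp ((‖z‖ + 1) * 2) * ‖t ^ (s + 1 - 1) * cutoff t‖)
    (Metric.ball_mem_nhds z one_pos)
    (Eventually.of_forall fun w => (integrableOn_exp_mul_cutoff hs w).aestronglyMeasurable)
    (integrableOn_exp_mul_cutoff hs z)
    (integrableOn_exp_mul_cutoff (by linarith) z).neg.aestronglyMeasurable
    ?_ (hi.norm.const_mul _) ?_).2
  · refine key.congr_deriv ?_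
    rw [integral_neg]
    rfl
  · refine (ae_restrict_iff' measurableSet_Ioi).2 (ae_of_all _ fun t (ht : 0 < t) w hw => ?_)
    rw [norm_neg, norm_mul, Complex.norm_real]
    rcases le_total 2 |t| with h2 | h2
    · simp [cutoff_eq_zero h2]
    · refine mul_le_mul_of_nonneg_right ?_ (norm_nonneg _)
      rw [abs_of_pos ht] at h2
      refine (Complex.norm_exp_le_exp_norm _).trans (Real.exp_le_exp.2 ?_)
      rw [norm_mul, norm_neg, Complex.norm_real, Real.norm_of_nonneg ht.le]
      have : ‖w‖ ≤ ‖z‖ + 1 := by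
        have h1 := norm_sub_norm_le w z
        have h3 : ‖w - z‖ < 1 := by simpa [dist_eq_norm] using hw
        linarith
      gcongr
  · refine (ae_restrict_iff' measurableSet_Ioi).2 (ae_of_all _ fun t (ht : 0 < t) w _ => ?_)
    have h1 : HasDerivAt (fun w : ℂ => -w * (t : ℂ)) (-1 * t) w :=
      (hasDerivAt_id w).neg.mul_const _
    have h2 := h1.cexp.mul_const ((t ^ (s - 1) * cutoff t : ℝ) : ℂ)
    refine h2.congr_deriv ?_
    have : t ^ (s + 1 - 1) = t ^ (s - 1) * t := by
      rw [← Real.rpow_add_one ht.ne']; congr 1; ring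
    rw [this]; push_cast; ring

/-- The boundary-layer term `t ^ s` times the derivative of `cutoff` on the positive half-line. -/
noncomputable def cutoffTail (s : ℝ) (t : ℝ) : ℂ :=
  if 0 < t then ((t ^ s * deriv cutoff t : ℝ) : ℂ) else 0

theorem deriv_cutoff_eq_zero {t : ℝ} (ht : |t| < 1) : deriv cutoff t = 0 := by
  rw [(cutoff_eventuallyEq_one ht).deriv_eq]
  exact deriv_const t 1

theorem cutoffTail_eq_zero (s : ℝ) {t : ℝ} (ht : t < 1) : cutoffTail s t = 0 := by
  unfold cutoffTail
  split_ifs with h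
  · rw [deriv_cutoff_eq_zero (by rw [abs_of_pos h]; exact ht)]; simp
  · rfl

theorem contDiff_cutoffTail (s : ℝ) : ContDiff ℝ (⊤ : ℕ∞) (cutoffTail s) := by
  rw [contDiff_iff_contDiffAt]
  intro t
  rcases lt_or_ge t 1 with ht | ht
  · refine (contDiffAt_const (c := (0 : ℂ))).congr_of_eventuallyEq ?_
    filter_upwards [Iio_mem_nhds ht] with x hx using cutoffTail_eq_zero s hx
  · have ht0 : 0 < t := one_pos.trans_le ht
    have hd : ContDiff ℝ (⊤ : ℕ∞) (deriv (cutoff : ℝ → ℝ)) := by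
      have := cutoff.contDiff (n := (⊤ : ℕ∞))
      fun_prop
    have h : ContDiffAt ℝ (⊤ : ℕ∞) (fun x : ℝ => ((x ^ s * deriv cutoff x : ℝ) : ℂ)) t :=
      Complex.ofRealCLM.contDiff.contDiffAt.comp t
        ((Real.contDiffAt_rpow_const_of_ne ht0.ne').mul hd.contDiffAt)
    refine h.congr_of_eventuallyEq ?_
    filter_upwards [Ioi_mem_nhds ht0] with x hx
    exact if_pos hx

theorem hasCompactSupport_cutoffTail (s : ℝ) : HasCompactSupport (cutoffTail s) := by
  refine cutoff.hasCompactSupport.deriv.mono fun t ht h => ht ?_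
  simp [cutoffTail, h]

theorem mul_truncLaplace_add_one {s : ℝ} (hs : 0 < s) (z : ℂ) :
    z * truncLaplace (s + 1) z =
      s * truncLaplace s z + ∫ t : ℝ, Complex.exp (-z * t) * cutoffTail s t := by
  have hA := integrableOn_exp_mul_cutoff hs z
  have hB := integrableOn_exp_mul_cutoff (s := s + 1) (by linarith) z
  have hC : Integrable fun t : ℝ => Complex.exp (-z * t) * cutoffTail s t :=
    ((by fun_prop : Continuous fun t : ℝ => Complex.exp (-z * t)).mul
      (contDiff_cutoffTail s).continuous).integrable_of_hasCompactSupport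
        (hasCompactSupport_cutoffTail s).mul_left
  have hC' : ∫ t : ℝ, Complex.exp (-z * t) * cutoffTail s t =
      ∫ t in Ioi (0 : ℝ), Complex.exp (-z * t) * cutoffTail s t := by
    rw [← integral_indicator measurableSet_Ioi]
    congr 1; ext t
    by_cases h : t ∈ Ioi (0 : ℝ)
    · rw [indicator_of_mem h]
    · rw [indicator_of_notMem h, cutoffTail_eq_zero s (by simp at h; linarith), mul_zero]
  have h0 : ∫ t in Ioi (0 : ℝ),
      ((s * (Complex.exp (-z * t) * ((t ^ (s - 1) * cutoff t : ℝ) : ℂ)) +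
        Complex.exp (-z * t) * cutoffTail s t) -
        z * (Complex.exp (-z * t) * ((t ^ (s + 1 - 1) * cutoff t : ℝ) : ℂ))) = 0 := by
    have := integral_Ioi_of_hasDerivAt_of_tendsto (a := 0) (m := (0 : ℂ))
      (f := fun t : ℝ => Complex.exp (-z * t) * ((t ^ s * cutoff t : ℝ) : ℂ))
      (f' := fun t : ℝ => ((s * (Complex.exp (-z * t) * ((t ^ (s - 1) * cutoff t : ℝ) : ℂ)) +
        Complex.exp (-z * t) * cutoffTail s t) -
        z * (Complex.exp (-z * t) * ((t ^ (s + 1 - 1) * cutoff t : ℝ) : ℂ)))) ?_ ?_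
      (((hA.const_mul _).add hC.integrableOn).sub (hB.const_mul _)) ?_
    · simpa [Real.zero_rpow hs.ne'] using this
    · refine Continuous.continuousWithinAt ?_
      have h1 : Continuous fun t : ℝ => t ^ s := Real.continuous_rpow_const hs.le
      have h2 := cutoff.continuous
      fun_prop
    · intro t (ht : 0 < t)
      have h1 : HasDerivAt (fun t : ℝ => Complex.exp (-z * t)) (Complex.exp (-z * t) * -z) t := by
        have : HasDerivAt (fun t : ℝ => -z * (t : ℂ)) (-z * 1) t :=
          (Complex.ofRealCLM.hasDerivAt (x := t)).const_mul (-z)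
        simpa using this.cexp
      have h2 : HasDerivAt (cutoff : ℝ → ℝ) (deriv cutoff t) t :=
        ((cutoff.contDiff (n := 1)).differentiable (by simp) t).hasDerivAt
      have h3 := (h1.mul ((Real.hasDerivAt_rpow_const (p := s) (Or.inl ht.ne')).mul h2).ofReal_comp)
      refine h3.congr_deriv ?_
      rw [cutoffTail, if_pos ht, add_sub_cancel_right]
      simp only [Pi.mul_apply]
      push_cast
      ring
    · refine tendsto_const_nhds.congr' ?_
      filter_upwards [eventually_ge_atTop (2 : ℝ)] with t ht
      simp [cutoff_eq_zero (ht.trans (le_abs_self t))]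
  have hAC : IntegrableOn (fun t : ℝ => s * (Complex.exp (-z * t) *
      ((t ^ (s - 1) * cutoff t : ℝ) : ℂ)) + Complex.exp (-z * t) * cutoffTail s t) (Ioi 0) :=
    (hA.const_mul _).add hC.integrableOn
  rw [integral_sub hAC (hB.const_mul _), integral_add (hA.const_mul _) hC.integrableOn,
    integral_const_mul, integral_const_mul,
    ← hC', sub_eq_zero] at h0
  exact h0.symm

theorem exists_norm_truncLaplace_ofReal_sub_le {s : ℝ} (hs : 0 < s) (L : ℕ) :
    ∃ C, ∀ R : ℝ, 1 ≤ R →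
      R ^ L * ‖truncLaplace s R - ((Real.Gamma s * R ^ (-s) : ℝ) : ℂ)‖ ≤ C := by
  refine ⟨L.factorial * (Real.exp 1 * Real.Gamma s), fun R hR => ?_⟩
  have hR0 : 0 < R := one_pos.trans_le hR
  have hG : IntegrableOn (fun t : ℝ => Real.exp (-t) * t ^ (s - 1)) (Ioi 0) :=
    Real.GammaIntegral_convergent hs
  have hT : truncLaplace s R =
      ((∫ t in Ioi (0 : ℝ), Real.exp (-(R * t)) * (t ^ (s - 1) * cutoff t) : ℝ) : ℂ) := by
    rw [truncLaplace, ← integral_complex_ofReal]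
    congr 1; ext t; push_cast; simp
  have hI : Real.Gamma s * R ^ (-s) =
      ∫ t in Ioi (0 : ℝ), t ^ (s - 1) * Real.exp (-(R * t)) := by
    rw [Real.integral_rpow_mul_exp_neg_mul_Ioi hs hR0, Real.rpow_neg hR0.le, one_div,
      Real.inv_rpow hR0.le, mul_comm]
  have hE : IntegrableOn (fun t : ℝ => t ^ (s - 1) * Real.exp (-(R * t))) (Ioi 0) := by
    refine hG.mono' ?_ ?_
    · refine ContinuousOn.aestronglyMeasurable (fun t (ht : 0 < t) => ?_) measurableSet_Ioi
      have := (Real.continuousAt_rpow_const t (s - 1) (Or.inl ht.ne')).continuousWithinAt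
        (s := Ioi (0 : ℝ))
      fun_prop
    · refine (ae_restrict_iff' measurableSet_Ioi).2 (ae_of_all _ fun t (ht : 0 < t) => ?_)
      rw [Real.norm_of_nonneg (by positivity), mul_comm]
      gcongr
      nlinarith
  have hE' : IntegrableOn (fun t : ℝ => Real.exp (-(R * t)) * (t ^ (s - 1) * cutoff t))
      (Ioi 0) := by
    refine (hE.mul_bdd (c := 1) cutoff.continuous.aestronglyMeasurable
      (ae_of_all _ fun t => ?_)).congr (ae_of_all _ fun t => ?_)
    · rw [Real.norm_of_nonneg cutoff.nonneg]
      exact cutoff.le_one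
    · show t ^ (s - 1) * Real.exp (-(R * t)) * cutoff t = _
      ring
  have hle : ‖truncLaplace s R - ((Real.Gamma s * R ^ (-s) : ℝ) : ℂ)‖ ≤
      Real.exp (1 - R) * Real.Gamma s := by
    rw [hT, hI, ← Complex.ofReal_sub, Complex.norm_real, ← integral_sub hE' hE,
      Real.Gamma_eq_integral hs, ← integral_const_mul]
    refine norm_integral_le_of_norm_le (hG.const_mul _)
      ((ae_restrict_iff' measurableSet_Ioi).2 (ae_of_all _ fun t (ht : 0 < t) => ?_))
    rcases le_total t 1 with h1 | h1
    · rw [cutoff_eq_one (by rwa [abs_of_pos ht]), mul_one, mul_comm, sub_self, norm_zero]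
      positivity
    · have h2 : Real.exp (-(R * t)) * (t ^ (s - 1) * cutoff t) -
          t ^ (s - 1) * Real.exp (-(R * t)) =
          -((1 - cutoff t) * (Real.exp (-(R * t)) * t ^ (s - 1))) := by ring
      have h3 : 0 ≤ 1 - cutoff t := sub_nonneg.2 cutoff.le_one
      have h4 : 1 - cutoff t ≤ 1 := by linarith [cutoff.nonneg (x := t)]
      rw [h2, norm_neg, Real.norm_of_nonneg (by positivity), ← mul_assoc (Real.exp (1 - R)),
        ← Real.exp_add]
      refine (mul_le_of_le_one_left (by positivity) h4).trans ?_
      gcongr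
      nlinarith
  have hpow : R ^ L ≤ L.factorial * Real.exp R := by
    have := Real.pow_div_factorial_le_exp R hR0.le L
    rwa [div_le_iff₀ (by positivity), mul_comm] at this
  calc R ^ L * ‖truncLaplace s R - ((Real.Gamma s * R ^ (-s) : ℝ) : ℂ)‖
      ≤ (L.factorial * Real.exp R) * (Real.exp (1 - R) * Real.Gamma s) := by gcongr
    _ = L.factorial * (Real.exp 1 * Real.Gamma s) := by
      rw [sub_eq_add_neg, Real.exp_add, Real.exp_neg]
      field_simp

theorem exists_norm_truncLaplace_imaginary_sub_le {s : ℝ} (hs : 0 < s) (L : ℕ) :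
    ∃ C, ∀ R : ℝ, 1 ≤ R → ∀ τ : ℝ, τ = 1 ∨ τ = -1 →
      R ^ L * ‖truncLaplace s (-(Complex.I * τ * R)) -
        Complex.exp (τ * Complex.I * ((Real.pi * s / 2 : ℝ) : ℂ)) *
          ((Real.Gamma s * R ^ (-s) : ℝ) : ℂ)‖ ≤ C := by
  obtain ⟨C₀, hC₀⟩ := exists_norm_truncLaplace_ofReal_sub_le hs L
  obtain ⟨C₁, hC₁⟩ := exists_norm_laplace_le L (cutoffTail s) (contDiff_cutoffTail s)
    (hasCompactSupport_cutoffTail s) fun t ht => cutoffTail_eq_zero s (by linarith)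
  refine ⟨C₁ * (Real.pi / 2) + C₀, fun R hR τ hτ => ?_⟩
  have hR0 : 0 < R := one_pos.trans_le hR
  set z : ℝ → ℂ := fun θ => R * Complex.exp (Complex.I * θ) with hz
  set u : ℝ → ℂ := fun θ => Complex.exp (Complex.I * s * θ) * truncLaplace s (z θ) with hu
  have hzd : ∀ θ : ℝ, HasDerivAt z (Complex.I * z θ) θ := fun θ => by
    have h1 : HasDerivAt (fun θ : ℝ => Complex.I * (θ : ℂ)) (Complex.I * 1) θ :=
      (Complex.ofRealCLM.hasDerivAt (x := θ)).const_mul _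
    refine (h1.cexp.const_mul (R : ℂ)).congr_deriv ?_
    simp only [hz]; ring
  have hud : ∀ θ : ℝ, HasDerivAt u (-(Complex.I * Complex.exp (Complex.I * s * θ) *
      ∫ t : ℝ, Complex.exp (-z θ * t) * cutoffTail s t)) θ := fun θ => by
    have h1 : HasDerivAt (fun θ : ℝ => Complex.I * s * (θ : ℂ)) (Complex.I * s * 1) θ :=
      (Complex.ofRealCLM.hasDerivAt (x := θ)).const_mul _
    have h2 := (hasDerivAt_truncLaplace hs (z θ)).comp θ (hzd θ)
    refine (h1.cexp.mul h2).congr_deriv ?_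
    rw [Function.comp_apply]
    linear_combination (-Complex.I * Complex.exp (Complex.I * s * θ)) *
      mul_truncLaplace_add_one hs (z θ)
  have hnorm_exp : ∀ y : ℝ, ‖Complex.exp (Complex.I * s * y)‖ = 1 := fun y => by
    rw [Complex.norm_exp]; simp
  have hznorm : ∀ θ, ‖z θ‖ = R := fun θ => by
    simp only [hz]
    rw [norm_mul, Complex.norm_real, Real.norm_of_nonneg hR0.le, Complex.norm_exp]; simp
  have hzre : ∀ θ ∈ Icc (-(Real.pi / 2)) (Real.pi / 2), 0 ≤ (z θ).re := fun θ hθ => by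
    have : (z θ).re = R * Real.cos θ := by
      simp only [hz]
      rw [Complex.re_ofReal_mul, mul_comm Complex.I, Complex.exp_ofReal_mul_I_re]
    rw [this]
    exact mul_nonneg hR0.le (Real.cos_nonneg_of_mem_Icc hθ)
  have hτabs : |τ| = 1 := by rcases hτ with rfl | rfl <;> simp
  have hmem : -(τ * (Real.pi / 2)) ∈ Icc (-(Real.pi / 2)) (Real.pi / 2) := by
    have := Real.pi_pos
    rcases hτ with rfl | rfl <;> constructor <;> linarith
  have hmem0 : (0 : ℝ) ∈ Icc (-(Real.pi / 2)) (Real.pi / 2) := by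
    have := Real.pi_pos
    constructor <;> linarith
  have hrot : R ^ L * ‖u (-(τ * (Real.pi / 2))) - u 0‖ ≤ C₁ * (Real.pi / 2) := by
    have := (convex_Icc (-(Real.pi / 2)) (Real.pi / 2)).norm_image_sub_le_of_norm_hasDerivWithin_le
      (f := u) (C := C₁ / R ^ L) (fun θ _ => (hud θ).hasDerivWithinAt) (fun θ hθ => by
        rw [norm_neg, norm_mul, norm_mul, Complex.norm_I, hnorm_exp, one_mul, one_mul,
          le_div_iff₀ (by positivity), mul_comm]
        simpa only [hznorm] using hC₁ (z θ) (hzre θ hθ)) hmem0 hmem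
    rw [sub_zero, norm_neg, norm_mul, Real.norm_eq_abs τ, hτabs, one_mul,
      Real.norm_of_nonneg (by positivity), div_mul_eq_mul_div, le_div_iff₀ (by positivity)] at this
    rwa [mul_comm]
  have hu0 : u 0 = truncLaplace s R := by simp [hu, hz]
  have hzτ : z (-(τ * (Real.pi / 2))) = -(Complex.I * τ * R) := by
    have : Complex.exp (Complex.I * ((Real.pi / 2 : ℝ) : ℂ)) = Complex.I := by
      rw [mul_comm]; push_cast; exact Complex.exp_pi_div_two_mul_I
    simp only [hz]
    rcases hτ with rfl | rfl
    · rw [one_mul, Complex.ofReal_neg, mul_neg, Complex.exp_neg, this, Complex.inv_I]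
      push_cast; ring
    · rw [neg_one_mul, neg_neg, this]
      push_cast; ring
  set w := Complex.exp (τ * Complex.I * ((Real.pi * s / 2 : ℝ) : ℂ)) with hw
  have hwu : w * Complex.exp (Complex.I * s * ((-(τ * (Real.pi / 2)) : ℝ) : ℂ)) = 1 := by
    rw [hw, ← Complex.exp_add, ← Complex.exp_zero]
    congr 1; push_cast; ring
  have hwn : ‖w‖ = 1 := by
    rw [hw, Complex.norm_exp]; simp
  have hsplit : truncLaplace s (-(Complex.I * τ * R)) - w * ((Real.Gamma s * R ^ (-s) : ℝ) : ℂ) =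
      w * ((u (-(τ * (Real.pi / 2))) - u 0) +
        (truncLaplace s R - ((Real.Gamma s * R ^ (-s) : ℝ) : ℂ))) := by
    rw [hu0]
    simp only [hu]
    rw [hzτ]
    linear_combination (-truncLaplace s (-(Complex.I * τ * R))) * hwu
  rw [hsplit, norm_mul, hwn, one_mul]
  calc _ ≤ R ^ L * (‖u (-(τ * (Real.pi / 2))) - u 0‖ +
        ‖truncLaplace s R - ((Real.Gamma s * R ^ (-s) : ℝ) : ℂ)‖) := by
        gcongr; exact norm_add_le _ _
    _ ≤ _ := by rw [mul_add]; exact add_le_add hrot (hC₀ R hR)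

/-- The coefficient `c^±_{m,k}` of the one-dimensional monomial oscillatory expansion. -/
noncomputable def monomialCoeff (m k : ℕ) (σ : ℝ) : ℂ :=
  (m : ℂ)⁻¹ *
    (Complex.exp (σ * Complex.I * ((Real.pi * ((k : ℝ) + 1) / (2 * m) : ℝ) : ℂ)) +
      (-1 : ℂ) ^ k *
        Complex.exp ((σ * (-1) ^ m : ℝ) * Complex.I *
          ((Real.pi * ((k : ℝ) + 1) / (2 * m) : ℝ) : ℂ))) *
    Complex.Gamma ((((k : ℝ) + 1) / (m : ℝ) : ℝ) : ℂ)

/-- The cut-off monomial `x ^ k` whose cutoff is a function of `x ^ m`. -/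
noncomputable def cutMonomial (m k : ℕ) (x : ℝ) : ℂ := ((x ^ k * cutoff (x ^ m) : ℝ) : ℂ)

theorem contDiff_cutMonomial (m k : ℕ) : ContDiff ℝ (⊤ : ℕ∞) (cutMonomial m k) := by
  have h := cutoff.contDiff (n := (⊤ : ℕ∞))
  exact Complex.ofRealCLM.contDiff.comp ((contDiff_id.pow k).mul (h.comp (contDiff_id.pow m)))

theorem cutoff_pow_eq_zero {m : ℕ} (hm : 1 ≤ m) {x : ℝ} (hx : 2 ≤ |x|) : cutoff (x ^ m) = 0 :=
  cutoff_eq_zero (by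
    rw [abs_pow]
    exact hx.trans (le_self_pow₀ (by linarith) (by omega)))

theorem hasCompactSupport_cutMonomial {m : ℕ} (hm : 1 ≤ m) (k : ℕ) :
    HasCompactSupport (cutMonomial m k) :=
  HasCompactSupport.intro (isCompact_Icc (a := (-2 : ℝ)) (b := 2)) fun x hx => by
    have : 2 ≤ |x| := by
      by_contra h
      exact hx (abs_le.1 (not_le.1 h).le)
    simp [cutMonomial, cutoff_pow_eq_zero hm this]

theorem integral_Ioi_exp_mul_cutMonomial {m : ℕ} (hm : 1 ≤ m) (k : ℕ) (τ R : ℝ) :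
    ∫ x in Ioi (0 : ℝ), Complex.exp (Complex.I * R * ((τ * x ^ m : ℝ) : ℂ)) * cutMonomial m k x =
      (m : ℂ)⁻¹ * truncLaplace (((k : ℝ) + 1) / m) (-(Complex.I * τ * R)) := by
  have hm0 : (0 : ℝ) < m := by exact_mod_cast hm
  rw [truncLaplace, ← integral_comp_rpow_Ioi_of_pos (g := fun t : ℝ =>
    Complex.exp (-(-(Complex.I * τ * R)) * t) *
      ((t ^ (((k : ℝ) + 1) / m - 1) * cutoff t : ℝ) : ℂ)) hm0, ← integral_const_mul]
  refine setIntegral_congr_fun measurableSet_Ioi fun x (hx : 0 < x) => ?_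
  have hk : x ^ k = x ^ ((m : ℝ) - 1) * (x ^ m) ^ (((k : ℝ) + 1) / m - 1) := by
    rw [← Real.rpow_natCast x m, ← Real.rpow_mul hx.le, ← Real.rpow_add hx, ← Real.rpow_natCast]
    congr 1
    field_simp
    ring
  have hmc : (m : ℂ) ≠ 0 := by exact_mod_cast hm0.ne'
  simp only [cutMonomial, Real.rpow_natCast, hk, Complex.real_smul]
  push_cast
  field_simp

theorem exists_norm_integral_exp_mul_cutMonomial_sub_le {m : ℕ} (hm : 1 ≤ m) (k : ℕ) {σ : ℝ}
    (hσ : σ = 1 ∨ σ = -1) (L : ℕ) :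
    ∃ C, ∀ R : ℝ, 1 ≤ R →
      R ^ L * ‖(∫ x : ℝ, Complex.exp (Complex.I * R * ((σ * x ^ m : ℝ) : ℂ)) * cutMonomial m k x) -
        monomialCoeff m k σ * ((R ^ (-(((k : ℝ) + 1) / m)) : ℝ) : ℂ)‖ ≤ C := by
  have hm0 : (0 : ℝ) < m := by exact_mod_cast hm
  have hs : 0 < ((k : ℝ) + 1) / m := by positivity
  obtain ⟨C, hC⟩ := exists_norm_truncLaplace_imaginary_sub_le hs L
  refine ⟨‖(m : ℂ)⁻¹‖ * (C + C), fun R hR => ?_⟩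
  have hexp : Integrable fun x : ℝ =>
      Complex.exp (Complex.I * R * ((σ * x ^ m : ℝ) : ℂ)) * cutMonomial m k x :=
    ((by fun_prop : Continuous fun x : ℝ =>
      Complex.exp (Complex.I * R * ((σ * x ^ m : ℝ) : ℂ))).mul
        (contDiff_cutMonomial m k).continuous).integrable_of_hasCompactSupport
          (hasCompactSupport_cutMonomial hm k).mul_left
  have hneg : ∫ x in Iic (0 : ℝ),
      Complex.exp (Complex.I * R * ((σ * x ^ m : ℝ) : ℂ)) * cutMonomial m k x =
      (-1) ^ k * ∫ x in Ioi (0 : ℝ),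
        Complex.exp (Complex.I * R * (((σ * (-1) ^ m) * x ^ m : ℝ) : ℂ)) * cutMonomial m k x := by
    have := integral_comp_neg_Ioi (0 : ℝ) fun x : ℝ =>
      Complex.exp (Complex.I * R * ((σ * x ^ m : ℝ) : ℂ)) * cutMonomial m k x
    rw [neg_zero] at this
    rw [← this, ← integral_const_mul]
    congr 1; ext x
    have hc : cutoff ((-x) ^ m) = cutoff (x ^ m) := by
      rcases Nat.even_or_odd m with h | h
      · rw [h.neg_pow]
      · rw [h.neg_pow, cutoff.neg]
    rw [cutMonomial, cutMonomial, hc, neg_pow x m, neg_pow x k]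
    push_cast
    ring_nf
  have hτ : σ * (-1) ^ m = 1 ∨ σ * (-1) ^ m = -1 := by
    rcases hσ with rfl | rfl <;> rcases neg_one_pow_eq_or ℝ m with h | h <;> simp [h]
  have hsplit := intervalIntegral.integral_Iic_add_Ioi (b := (0 : ℝ)) hexp.integrableOn
    hexp.integrableOn
  rw [← hsplit, hneg, integral_Ioi_exp_mul_cutMonomial hm, integral_Ioi_exp_mul_cutMonomial hm]
  have h1 := hC R hR σ hσ
  have h2 := hC R hR _ hτ
  have hpi : Real.pi * (((k : ℝ) + 1) / m) / 2 = Real.pi * ((k : ℝ) + 1) / (2 * m) := by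
    field_simp
  rw [hpi] at h1 h2
  set E₁ := Complex.exp (σ * Complex.I * ((Real.pi * ((k : ℝ) + 1) / (2 * m) : ℝ) : ℂ)) with hE₁
  set E₂ := Complex.exp ((σ * (-1) ^ m : ℝ) * Complex.I *
          ((Real.pi * ((k : ℝ) + 1) / (2 * m) : ℝ) : ℂ)) with hE₂
  set T₁ := truncLaplace (((k : ℝ) + 1) / m) (-(Complex.I * σ * R))
  set T₂ := truncLaplace (((k : ℝ) + 1) / m) (-(Complex.I * ((σ * (-1) ^ m : ℝ) : ℂ) * R))
  set G := ((Real.Gamma (((k : ℝ) + 1) / m) * R ^ (-(((k : ℝ) + 1) / m)) : ℝ) : ℂ) with hG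
  have heq : (-1) ^ k * ((m : ℂ)⁻¹ * T₂) + (m : ℂ)⁻¹ * T₁ -
      monomialCoeff m k σ * ((R ^ (-(((k : ℝ) + 1) / m)) : ℝ) : ℂ) =
      (m : ℂ)⁻¹ * ((T₁ - E₁ * G) + (-1) ^ k * (T₂ - E₂ * G)) := by
    rw [monomialCoeff, ← hE₁, ← hE₂, hG, Complex.Gamma_ofReal]
    push_cast
    ring
  rw [heq, norm_mul, mul_left_comm]
  gcongr
  calc _ ≤ R ^ L * (‖T₁ - E₁ * G‖ + ‖T₂ - E₂ * G‖) := by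
        gcongr
        refine (norm_add_le _ _).trans ?_
        rw [norm_mul, norm_pow, norm_neg, norm_one, one_pow, one_mul]
    _ ≤ _ := by rw [mul_add]; exact add_le_add h1 h2

/-! ### Coordinate derivatives of smooth functions -/

theorem hasDerivAt_pderiv {n : ℕ} {g : (Fin n → ℝ) → ℂ} (hg : Differentiable ℝ g) (j : Fin n)
    (x : Fin n → ℝ) :
    HasDerivAt (fun t : ℝ => g (Function.update x j t)) (pderiv j g x) (x j) :=
  ((hg _).comp (x j) (hasDerivAt_update x j (x j)).differentiableAt).hasDerivAt

theorem pderiv_eq_fderiv {n : ℕ} {g : (Fin n → ℝ) → ℂ} (hg : Differentiable ℝ g) (j : Fin n)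
    (x : Fin n → ℝ) : pderiv j g x = fderiv ℝ g x (Pi.single j 1) := by
  have h := (hg (Function.update x j (x j))).hasFDerivAt.comp_hasDerivAt (x j)
    (hasDerivAt_update x j (x j))
  rw [Function.update_eq_self] at h
  exact h.deriv

theorem contDiff_pderiv {n : ℕ} {g : (Fin n → ℝ) → ℂ} (hg : ContDiff ℝ (⊤ : ℕ∞) g)
    (j : Fin n) : ContDiff ℝ (⊤ : ℕ∞) (pderiv j g) := by
  have : pderiv j g = fun x => fderiv ℝ g x (Pi.single j 1) :=
    funext fun x => pderiv_eq_fderiv (hg.differentiable (by simp)) j x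
  rw [this]
  exact (hg.fderiv_right (m := (⊤ : ℕ∞)) (by simp)).clm_apply contDiff_const

/-- Smooth compactly supported functions. -/
def IsTestFunction {n : ℕ} (f : (Fin n → ℝ) → ℂ) : Prop :=
  ContDiff ℝ (⊤ : ℕ∞) f ∧ HasCompactSupport f

theorem IsTestFunction.pderiv {n : ℕ} {f : (Fin n → ℝ) → ℂ} (hf : IsTestFunction f)
    (j : Fin n) : IsTestFunction (pderiv j f) := by
  refine ⟨contDiff_pderiv hf.1 j, ?_⟩
  have : _root_.pderiv j f = fun x => fderiv ℝ f x (Pi.single j 1) :=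
    funext fun x => pderiv_eq_fderiv (hf.1.differentiable (by simp)) j x
  rw [this]
  exact hf.2.fderiv_apply (𝕜 := ℝ) _

theorem contDiff_iterate_pderiv {n : ℕ} {g : (Fin n → ℝ) → ℂ} (hg : ContDiff ℝ (⊤ : ℕ∞) g)
    (j : Fin n) (k : ℕ) : ContDiff ℝ (⊤ : ℕ∞) ((pderiv j)^[k] g) := by
  induction k with
  | zero => exact hg
  | succ k ih => rw [Function.iterate_succ_apply']; exact contDiff_pderiv ih j

theorem IsTestFunction.iterate_pderiv {n : ℕ} {f : (Fin n → ℝ) → ℂ} (hf : IsTestFunction f)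
    (j : Fin n) (k : ℕ) : IsTestFunction ((_root_.pderiv j)^[k] f) := by
  induction k with
  | zero => exact hf
  | succ k ih => rw [Function.iterate_succ_apply']; exact ih.pderiv j

theorem IsTestFunction.mul_left {n : ℕ} {f g : (Fin n → ℝ) → ℂ} (hf : IsTestFunction f)
    (hg : ContDiff ℝ (⊤ : ℕ∞) g) : IsTestFunction fun x => g x * f x :=
  ⟨hg.mul hf.1, hf.2.mul_left⟩

theorem IsTestFunction.integrable {n : ℕ} {f : (Fin n → ℝ) → ℂ} (hf : IsTestFunction f) :
    Integrable f :=
  hf.1.continuous.integrable_of_hasCompactSupport hf.2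

/-! ### Oscillatory integrals with monomial phase -/

/-- The oscillatory integral of `f` with phase `∑ j, σ j * x j ^ m j` and frequency `R`. -/
noncomputable def monomialOsc {n : ℕ} (m : Fin n → ℕ) (σ : Fin n → ℝ) (f : (Fin n → ℝ) → ℂ)
    (R : ℝ) : ℂ :=
  ∫ x : Fin n → ℝ, Complex.exp (Complex.I * R * ((∑ j, σ j * x j ^ m j : ℝ) : ℂ)) * f x

theorem contDiff_monomialPhase {n : ℕ} (m : Fin n → ℕ) (σ : Fin n → ℝ) (R : ℝ) :
    ContDiff ℝ (⊤ : ℕ∞) fun x : Fin n → ℝ =>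
      Complex.exp (Complex.I * R * ((∑ j, σ j * x j ^ m j : ℝ) : ℂ)) := by
  have h0 : ContDiff ℝ (⊤ : ℕ∞) fun x : Fin n → ℝ => ∑ j, σ j * x j ^ m j :=
    ContDiff.sum fun j _ => by fun_prop
  have h : ContDiff ℝ (⊤ : ℕ∞) fun x : Fin n → ℝ => ((∑ j, σ j * x j ^ m j : ℝ) : ℂ) :=
    Complex.ofRealCLM.contDiff.comp h0
  exact (contDiff_const.mul h).cexp

theorem norm_monomialPhase {n : ℕ} (m : Fin n → ℕ) (σ : Fin n → ℝ) (R : ℝ) (x : Fin n → ℝ) :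
    ‖Complex.exp (Complex.I * R * ((∑ j, σ j * x j ^ m j : ℝ) : ℂ))‖ = 1 := by
  rw [Complex.norm_exp]
  simp [-Complex.ofReal_sum]

theorem pderiv_monomialPhase {n : ℕ} (m : Fin n → ℕ) (σ : Fin n → ℝ) (R : ℝ) (j : Fin n)
    (x : Fin n → ℝ) :
    pderiv j (fun x : Fin n → ℝ =>
        Complex.exp (Complex.I * R * ((∑ j, σ j * x j ^ m j : ℝ) : ℂ))) x =
      Complex.exp (Complex.I * R * ((∑ j, σ j * x j ^ m j : ℝ) : ℂ)) *
        (Complex.I * R * ((σ j * (m j * x j ^ (m j - 1)) : ℝ) : ℂ)) := by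
  have h : HasDerivAt (fun t : ℝ => ∑ i, σ i * Function.update x j t i ^ m i)
      (σ j * (m j * x j ^ (m j - 1))) (x j) := by
    have : ∀ t : ℝ, ∑ i, σ i * Function.update x j t i ^ m i =
        σ j * t ^ m j + ∑ i ∈ Finset.univ.erase j, σ i * x i ^ m i := fun t => by
      rw [← Finset.add_sum_erase _ _ (Finset.mem_univ j), Function.update_self]
      congr 1
      refine Finset.sum_congr rfl fun i hi => ?_
      rw [Function.update_of_ne (Finset.ne_of_mem_erase hi)]
    simp only [this]
    exact ((hasDerivAt_pow (m j) (x j)).const_mul (σ j)).add_const _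
  have h2 := (h.ofReal_comp.const_mul (Complex.I * (R : ℂ))).cexp.deriv
  rw [Function.update_eq_self] at h2
  exact h2

theorem pderiv_coord_pow_mul {n : ℕ} {g : (Fin n → ℝ) → ℂ} (hg : Differentiable ℝ g)
    (j : Fin n) (k : ℕ) (x : Fin n → ℝ) :
    pderiv j (fun x => (x j : ℂ) ^ (k + 1) * g x) x =
      (x j : ℂ) ^ k * (((k : ℂ) + 1) * g x + x j * pderiv j g x) := by
  have h1 := hasDerivAt_pderiv hg j x
  have h2 : HasDerivAt (fun t : ℝ => (t : ℂ) ^ (k + 1)) (((k : ℂ) + 1) * (x j : ℂ) ^ k) (x j) := by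
    refine (((hasDerivAt_id (x j)).ofReal_comp).pow (k + 1)).congr_deriv ?_
    simp
  have h3 := (h2.mul h1).deriv
  rw [Function.update_eq_self] at h3
  unfold pderiv
  simp only [Function.update_self]
  refine h3.trans ?_
  unfold pderiv
  ring

theorem contDiff_coord {n : ℕ} (j : Fin n) :
    ContDiff ℝ (⊤ : ℕ∞) fun x : Fin n → ℝ => (x j : ℂ) :=
  Complex.ofRealCLM.contDiff.comp (contDiff_apply ℝ ℝ j)

theorem exists_norm_monomialOsc_le {n : ℕ} {m : Fin n → ℕ} (hm : ∀ j, 1 ≤ m j)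
    {σ : Fin n → ℝ} (hσ : ∀ j, σ j = 1 ∨ σ j = -1) (j : Fin n) (L : ℕ)
    (g : (Fin n → ℝ) → ℂ) (hg : IsTestFunction g) :
    ∃ C, ∀ R : ℝ, 1 ≤ R →
      R ^ L * ‖monomialOsc m σ (fun x => (x j : ℂ) ^ (m j * L) * g x) R‖ ≤ C := by
  induction L generalizing g with
  | zero =>
    refine ⟨∫ x, ‖g x‖, fun R _ => ?_⟩
    rw [pow_zero, one_mul]
    refine norm_integral_le_of_norm_le hg.integrable.norm (ae_of_all _ fun x => ?_)
    rw [norm_mul, norm_monomialPhase]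
    simp
  | succ L ih =>
    have hgd : Differentiable ℝ g := hg.1.differentiable (by simp)
    have hh : IsTestFunction fun x => ((m j * L : ℕ) + 1 : ℂ) * g x + x j * pderiv j g x :=
      ⟨((hg.mul_left contDiff_const).1).add (((hg.pderiv j).mul_left (contDiff_coord j)).1),
        (hg.mul_left contDiff_const).2.add ((hg.pderiv j).mul_left (contDiff_coord j)).2⟩
    obtain ⟨C, hC⟩ := ih _ hh
    refine ⟨C, fun R hR => ?_⟩
    have hR0 : 0 < R := one_pos.trans_le hR
    set u : (Fin n → ℝ) → ℂ := fun x =>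
      Complex.exp (Complex.I * R * ((∑ j, σ j * x j ^ m j : ℝ) : ℂ)) with hu
    have hus : ContDiff ℝ (⊤ : ℕ∞) u := contDiff_monomialPhase m σ R
    have hud : Differentiable ℝ u := hus.differentiable (by simp)
    set v : (Fin n → ℝ) → ℂ := fun x => (x j : ℂ) ^ (m j * L + 1) * g x with hv
    have hvt : IsTestFunction v := hg.mul_left ((contDiff_coord j).pow _)
    have hvd : Differentiable ℝ v := hvt.1.differentiable (by simp)
    have ibp : ∫ x, u x * pderiv j v x = -∫ x, pderiv j u x * v x := by
      simp only [fun x => pderiv_eq_fderiv hud j x, fun x => pderiv_eq_fderiv hvd j x]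
      refine integral_mul_fderiv_eq_neg_fderiv_mul_of_integrable ?_ ?_ ?_
        (fun x _ => hud x) (fun x _ => hvd x)
      · simp only [← fun x => pderiv_eq_fderiv hud j x]
        exact (hvt.mul_left (contDiff_pderiv hus j)).integrable
      · simp only [← fun x => pderiv_eq_fderiv hvd j x]
        exact ((hvt.pderiv j).mul_left hus).integrable
      · exact (hvt.mul_left hus).integrable
    have hleft : ∫ x, u x * pderiv j v x = monomialOsc m σ (fun x => (x j : ℂ) ^ (m j * L) *
        (((m j * L : ℕ) + 1 : ℂ) * g x + x j * pderiv j g x)) R := by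
      simp only [hv, pderiv_coord_pow_mul hgd]
      rfl
    have hright : ∫ x, pderiv j u x * v x = (Complex.I * R * (σ j * m j)) *
        monomialOsc m σ (fun x => (x j : ℂ) ^ (m j * (L + 1)) * g x) R := by
      rw [monomialOsc, ← integral_const_mul]
      congr 1; ext x
      have he : m j * (L + 1) = (m j - 1) + (m j * L + 1) := by
        have := hm j
        rw [mul_add]; omega
      rw [hu, pderiv_monomialPhase, hv, he]
      push_cast
      ring
    have hC' := hC R hR
    rw [← hleft, ibp, hright, norm_neg, norm_mul] at hC'
    have hcoef : R ≤ ‖Complex.I * R * (σ j * m j)‖ := by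
      have h1 : ‖(σ j : ℂ)‖ = 1 := by
        rw [Complex.norm_real]
        rcases hσ j with h | h <;> simp [h]
      have h2 : (1 : ℝ) ≤ m j := by exact_mod_cast hm j
      rw [norm_mul, norm_mul, norm_mul, Complex.norm_I, h1, Complex.norm_real,
        Real.norm_of_nonneg hR0.le, Complex.norm_natCast]
      nlinarith
    refine le_trans ?_ hC'
    rw [pow_succ, mul_assoc]
    gcongr

/-! ### Taylor expansion in one coordinate with smooth remainder -/

theorem contDiff_uncurry_update {n : ℕ} (j : Fin n) :
    ContDiff ℝ (⊤ : ℕ∞) fun p : (Fin n → ℝ) × ℝ => Function.update p.1 j p.2 := by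
  rw [contDiff_pi]
  intro i
  by_cases h : i = j
  · subst h
    simpa using contDiff_snd
  · simp only [Function.update_of_ne h]
    exact (contDiff_apply ℝ ℝ i).comp contDiff_fst

theorem exists_coord_quotient {n : ℕ} {f : (Fin n → ℝ) → ℂ} (hf : ContDiff ℝ (⊤ : ℕ∞) f)
    (j : Fin n) : ∃ q : (Fin n → ℝ) → ℂ, ContDiff ℝ (⊤ : ℕ∞) q ∧
      ∀ x, f x = f (Function.update x j 0) + x j * q x := by
  have hd := contDiff_pderiv hf j
  set F : (Fin n → ℝ) → ℝ → ℂ := fun p t => pderiv j f (Function.update p j (-t * p j)) with hF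
  have hFs : ContDiff ℝ (⊤ : ℕ∞) (Function.uncurry F) := by
    have h1 : ContDiff ℝ (⊤ : ℕ∞) fun p : (Fin n → ℝ) × ℝ => (p.1, -p.2 * p.1 j) :=
      contDiff_fst.prodMk (contDiff_snd.neg.mul ((contDiff_apply ℝ ℝ j).comp contDiff_fst))
    exact hd.comp ((contDiff_uncurry_update j).comp h1)
  set g : (Fin n → ℝ) → ℝ → ℂ := fun p t => ((cutoff t : ℝ) : ℂ) * F p t with hg
  have hgs : ContDiff ℝ (⊤ : ℕ∞) (Function.uncurry g) := by
    have h1 : ContDiff ℝ (⊤ : ℕ∞) fun p : (Fin n → ℝ) × ℝ => ((cutoff p.2 : ℝ) : ℂ) :=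
      Complex.ofRealCLM.contDiff.comp (cutoff.contDiff.comp contDiff_snd)
    exact h1.mul hFs
  have hI : LocallyIntegrable (indicator (Icc (0 : ℝ) 1) fun _ => (1 : ℝ)) volume :=
    ((integrable_indicator_iff measurableSet_Icc).2
      (integrableOn_const (by simp))).locallyIntegrable
  have hconv := contDiffOn_convolution_right_with_param_comp (μ := (volume : Measure ℝ))
    (n := (⊤ : ℕ∞)) (ContinuousLinearMap.lsmul ℝ ℝ : ℝ →L[ℝ] ℂ →L[ℝ] ℂ)
    (s := univ) (v := fun _ : Fin n → ℝ => (0 : ℝ)) contDiffOn_const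
    (g := g) isOpen_univ (isCompact_Icc (a := (-2 : ℝ)) (b := 2))
    (fun p t _ ht => by
      have : 2 ≤ |t| := by
        by_contra h
        exact ht (abs_le.1 (not_le.1 h).le)
      simp [hg, cutoff_eq_zero this]) hI hgs.contDiffOn
  refine ⟨_, contDiffOn_univ.1 hconv, fun x => ?_⟩
  have hq : convolution (indicator (Icc (0 : ℝ) 1) fun _ => (1 : ℝ)) (g x)
      (ContinuousLinearMap.lsmul ℝ ℝ) volume 0 =
      ∫ t in (0 : ℝ)..1, pderiv j f (Function.update x j (t * x j)) := by
    rw [convolution, intervalIntegral.integral_of_le zero_le_one, ← integral_Icc_eq_integral_Ioc,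
      ← integral_indicator measurableSet_Icc]
    congr 1; ext t
    by_cases ht : t ∈ Icc (0 : ℝ) 1
    · have h1 : cutoff (-t) = 1 := cutoff_eq_one (by
        rw [abs_neg, abs_of_nonneg ht.1]; exact ht.2)
      simp [indicator_of_mem ht, hg, hF, h1]
    · simp [indicator_of_notMem ht]
  have hftc : ∫ t in (0 : ℝ)..1, x j * pderiv j f (Function.update x j (t * x j)) =
      f x - f (Function.update x j 0) := by
    rw [intervalIntegral.integral_eq_sub_of_hasDerivAt
      (f := fun t : ℝ => f (Function.update x j (t * x j)))]
    · simp
    · intro t _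
      have h1 := hasDerivAt_pderiv (hf.differentiable (by simp)) j (Function.update x j (t * x j))
      simp only [Function.update_self, Function.update_idem] at h1
      have h2 := h1.scomp t (hasDerivAt_mul_const (x j))
      exact h2.congr_deriv (by simp)
    · refine Continuous.intervalIntegrable ?_ _ _
      have h1 : Continuous fun t : ℝ => Function.update x j (t * x j) := by fun_prop
      exact continuous_const.mul (hd.continuous.comp h1)
  rw [hq, ← intervalIntegral.integral_const_mul, hftc]
  ring

theorem iterate_pderiv_of_coord_quotient {n : ℕ} {f q : (Fin n → ℝ) → ℂ}
    (hq : ContDiff ℝ (⊤ : ℕ∞) q) {j : Fin n}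
    (h : ∀ x, f x = f (Function.update x j 0) + x j * q x) (k : ℕ) (x : Fin n → ℝ) :
    (pderiv j)^[k + 1] f x =
      ((k : ℂ) + 1) * (pderiv j)^[k] q x + x j * (pderiv j)^[k + 1] q x := by
  induction k generalizing x with
  | zero =>
    have h1 := hasDerivAt_pderiv (hq.differentiable (by simp)) j x
    have h2 : HasDerivAt (fun t : ℝ => (t : ℂ)) 1 (x j) := (hasDerivAt_id (x j)).ofReal_comp
    have h3 := ((h2.mul h1).const_add (f (Function.update x j 0)))
    have h4 : (fun t : ℝ => f (Function.update x j t)) = fun t : ℝ =>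
        f (Function.update x j 0) + t * q (Function.update x j t) := by
      ext t
      rw [h (Function.update x j t)]
      simp
    have h5 : pderiv j f x = 1 * q (Function.update x j (x j)) + x j * pderiv j q x :=
      (congrArg (fun u : ℝ → ℂ => deriv u (x j)) h4).trans h3.deriv
    rw [zero_add, Function.iterate_one, h5]
    simp
  | succ k ih =>
    have h1 := hasDerivAt_pderiv ((contDiff_iterate_pderiv hq j k).differentiable (by simp)) j x
    have h1' := hasDerivAt_pderiv
      ((contDiff_iterate_pderiv hq j (k + 1)).differentiable (by simp)) j x
    have h2 : HasDerivAt (fun t : ℝ => (t : ℂ)) 1 (x j) := (hasDerivAt_id (x j)).ofReal_comp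
    have h3 := (h1.const_mul ((k : ℂ) + 1)).add (h2.mul h1')
    rw [Function.iterate_succ_apply', show (pderiv j)^[k + 1] f = _ from funext ih]
    have h5 : pderiv j (fun x => ((k : ℂ) + 1) * (pderiv j)^[k] q x +
        x j * (pderiv j)^[k + 1] q x) x =
        ((k : ℂ) + 1) * pderiv j ((pderiv j)^[k] q) x +
          (1 * (pderiv j)^[k + 1] q (Function.update x j (x j)) +
            x j * pderiv j ((pderiv j)^[k + 1] q) x) := by
      rw [← h3.deriv, pderiv]
      simp only [Function.update_self]
      rfl
    rw [h5]
    simp only [Function.update_eq_self, ← Function.iterate_succ_apply' (pderiv j)]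
    push_cast
    ring

theorem exists_coord_taylor {n : ℕ} (j : Fin n) (K : ℕ) (f : (Fin n → ℝ) → ℂ)
    (hf : ContDiff ℝ (⊤ : ℕ∞) f) :
    ∃ g : (Fin n → ℝ) → ℂ, ContDiff ℝ (⊤ : ℕ∞) g ∧ ∀ x, f x =
      ∑ k ∈ Finset.range K,
        (pderiv j)^[k] f (Function.update x j 0) / (k.factorial : ℂ) * (x j : ℂ) ^ k +
      (x j : ℂ) ^ K * g x := by
  induction K generalizing f with
  | zero => exact ⟨f, hf, by simp⟩
  | succ K ih =>
    obtain ⟨q, hq, hfq⟩ := exists_coord_quotient hf j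
    obtain ⟨g, hg, hqg⟩ := ih q hq
    refine ⟨g, hg, fun x => ?_⟩
    rw [hfq x, hqg x, Finset.sum_range_succ', mul_add, Finset.mul_sum]
    have : ∀ k ∈ Finset.range K,
        x j * ((pderiv j)^[k] q (Function.update x j 0) / (k.factorial : ℂ) * (x j : ℂ) ^ k) =
        (pderiv j)^[k + 1] f (Function.update x j 0) / ((k + 1).factorial : ℂ) *
          (x j : ℂ) ^ (k + 1) := fun k _ => by
      rw [iterate_pderiv_of_coord_quotient hq hfq, Function.update_self, Nat.factorial_succ]
      have h1 : (k : ℂ) + 1 ≠ 0 := Nat.cast_add_one_ne_zero k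
      have h2 : (k.factorial : ℂ) ≠ 0 := by exact_mod_cast k.factorial_ne_zero
      push_cast
      field_simp
      ring
    rw [Finset.sum_congr rfl this]
    simp
    ring

/-- The `k`-th Taylor term of `f` in the `j`-th coordinate, cut off in that coordinate. -/
noncomputable def cutTaylorTerm {n : ℕ} (m : Fin n → ℕ) (j : Fin n) (k : ℕ)
    (f : (Fin n → ℝ) → ℂ) (x : Fin n → ℝ) : ℂ :=
  (pderiv j)^[k] f (Function.update x j 0) / (k.factorial : ℂ) * cutMonomial (m j) k (x j)

theorem IsTestFunction.cutTaylorTerm {n : ℕ} {m : Fin n → ℕ} (hm : ∀ j, 1 ≤ m j) (j : Fin n)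
    (k : ℕ) {f : (Fin n → ℝ) → ℂ} (hf : IsTestFunction f) :
    IsTestFunction (cutTaylorTerm m j k f) := by
  have hd := hf.iterate_pderiv j k
  constructor
  · have h1 : ContDiff ℝ (⊤ : ℕ∞) fun x : Fin n → ℝ => Function.update x j 0 :=
      (contDiff_uncurry_update j).comp (contDiff_id.prodMk contDiff_const)
    exact ((hd.1.comp h1).div_const _).mul
      ((contDiff_cutMonomial (m j) k).comp (contDiff_apply ℝ ℝ j))
  · obtain ⟨r, hr⟩ := hd.2.isCompact.isBounded.subset_closedBall (0 : Fin n → ℝ)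
    refine HasCompactSupport.intro (isCompact_closedBall (0 : Fin n → ℝ) (max r 2)) fun x hx => ?_
    rw [mem_closedBall_zero_iff, pi_norm_le_iff_of_nonneg (by positivity)] at hx
    push Not at hx
    obtain ⟨i, hi⟩ := hx
    rw [max_lt_iff] at hi
    rw [_root_.cutTaylorTerm]
    by_cases hij : i = j
    · subst hij
      simp [cutMonomial, cutoff_pow_eq_zero (hm i) hi.2.le]
    · rw [image_eq_zero_of_notMem_tsupport (f := (_root_.pderiv j)^[k] f), zero_div, zero_mul]
      intro hmem
      have h2 := (norm_le_pi_norm _ i).trans (mem_closedBall_zero_iff.1 (hr hmem))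
      rw [Function.update_of_ne hij] at h2
      exact absurd h2 (not_le.2 hi.1)

theorem exists_one_sub_cutoff_pow {m : ℕ} (hm : 1 ≤ m) (K : ℕ) :
    ∃ q : ℝ → ℂ, ContDiff ℝ (⊤ : ℕ∞) q ∧
      ∀ t, (1 : ℂ) - (cutoff (t ^ m) : ℝ) = (t : ℂ) ^ K * q t := by
  have hz : ∀ᶠ t : ℝ in 𝓝 0, cutoff (t ^ m) = 1 := by
    have h : Tendsto (fun t : ℝ => t ^ m) (𝓝 0) (𝓝 0) := by
      simpa [show m ≠ 0 by omega] using (continuous_pow m).tendsto (0 : ℝ)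
    exact h.eventually (cutoff_eventuallyEq_one (by simp))
  refine ⟨fun t => (1 - (cutoff (t ^ m) : ℝ)) / (t : ℂ) ^ K, ?_, fun t => ?_⟩
  · rw [contDiff_iff_contDiffAt]
    intro t
    by_cases ht : t = 0
    · subst ht
      refine (contDiffAt_const (c := (0 : ℂ))).congr_of_eventuallyEq ?_
      filter_upwards [hz] with t ht
      simp [ht]
    · have h1 : ContDiff ℝ (⊤ : ℕ∞) fun t : ℝ => (1 : ℂ) - (cutoff (t ^ m) : ℝ) :=
        contDiff_const.sub (Complex.ofRealCLM.contDiff.comp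
          (cutoff.contDiff.comp (contDiff_id.pow m)))
      have h2 : ContDiff ℝ (⊤ : ℕ∞) fun t : ℝ => (t : ℂ) ^ K :=
        (Complex.ofRealCLM.contDiff (n := (⊤ : ℕ∞))).pow K
      simp only [div_eq_mul_inv]
      exact h1.contDiffAt.mul (h2.contDiffAt.inv (by simp [ht]))
  · by_cases ht : t = 0
    · subst ht
      simp [hz.self_of_nhds]
    · have : (t : ℂ) ^ K ≠ 0 := by simp [ht]
      field_simp

theorem IsTestFunction.sub {n : ℕ} {f g : (Fin n → ℝ) → ℂ} (hf : IsTestFunction f)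
    (hg : IsTestFunction g) : IsTestFunction fun x => f x - g x :=
  ⟨hf.1.sub hg.1, by simp only [sub_eq_add_neg]; exact hf.2.add hg.2.neg⟩

theorem IsTestFunction.sum {n : ℕ} {ι : Type*} (s : Finset ι) {f : ι → (Fin n → ℝ) → ℂ}
    (hf : ∀ i ∈ s, IsTestFunction (f i)) : IsTestFunction fun x => ∑ i ∈ s, f i x := by
  classical
  induction s using Finset.induction_on with
  | empty => exact ⟨by simpa using contDiff_const, by simpa using! HasCompactSupport.zero⟩
  | insert i s hi ih =>
    simp only [Finset.sum_insert hi]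
    have h1 := hf i (Finset.mem_insert_self i s)
    have h2 := ih fun k hk => hf k (Finset.mem_insert_of_mem hk)
    exact ⟨h1.1.add h2.1, h1.2.add h2.2⟩

theorem exists_cutTaylor_remainder {n : ℕ} {m : Fin n → ℕ} (hm : ∀ j, 1 ≤ m j) (j : Fin n)
    (K : ℕ) {f : (Fin n → ℝ) → ℂ} (hf : IsTestFunction f) :
    ∃ g, IsTestFunction g ∧ ∀ x, f x =
      ∑ k ∈ Finset.range K, cutTaylorTerm m j k f x + (x j : ℂ) ^ K * g x := by
  obtain ⟨g, hg, hfg⟩ := exists_coord_taylor j K f hf.1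
  obtain ⟨q, hq, hcq⟩ := exists_one_sub_cutoff_pow (hm j) K
  have hD := hf.sub (IsTestFunction.sum (Finset.range K) (f := fun k => cutTaylorTerm m j k f)
    fun k _ => hf.cutTaylorTerm hm j k)
  obtain ⟨r, hr⟩ := hD.2.isCompact.isBounded.subset_closedBall (0 : Fin n → ℝ)
  let ρ : ContDiffBump (0 : Fin n → ℝ) :=
    ⟨max r 1, max r 1 + 1, by positivity, by linarith⟩
  have hρ : IsTestFunction fun x : Fin n → ℝ => ((ρ x : ℝ) : ℂ) :=
    ⟨Complex.ofRealCLM.contDiff.comp ρ.contDiff,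
      ρ.hasCompactSupport.comp_left (g := Complex.ofReal) Complex.ofReal_zero⟩
  have hρD : ∀ x, f x - ∑ k ∈ Finset.range K, cutTaylorTerm m j k f x =
      ρ x * (f x - ∑ k ∈ Finset.range K, cutTaylorTerm m j k f x) := fun x => by
    by_cases hx : x ∈ Metric.closedBall (0 : Fin n → ℝ) (max r 1)
    · rw [ρ.one_of_mem_closedBall hx, Complex.ofReal_one, one_mul]
    · have : f x - ∑ k ∈ Finset.range K, cutTaylorTerm m j k f x = 0 :=
        image_eq_zero_of_notMem_tsupport
          (f := fun x => f x - ∑ k ∈ Finset.range K, cutTaylorTerm m j k f x) fun h =>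
          hx (Metric.closedBall_subset_closedBall (le_max_left _ _) (hr h))
      rw [this, mul_zero]
  have hχ : ContDiff ℝ (⊤ : ℕ∞) fun x : Fin n → ℝ => ((cutoff (x j ^ m j) : ℝ) : ℂ) :=
    Complex.ofRealCLM.contDiff.comp
      (cutoff.contDiff.comp ((contDiff_apply ℝ ℝ j).pow (m j)))
  refine ⟨_, hρ.mul_left (((hq.comp (contDiff_apply ℝ ℝ j)).mul hf.1).add (hχ.mul hg)),
    fun x => ?_⟩
  rw [← sub_eq_iff_eq_add', hρD x]
  have hT : ∑ k ∈ Finset.range K, cutTaylorTerm m j k f x =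
      (cutoff (x j ^ m j) : ℝ) * (f x - (x j : ℂ) ^ K * g x) := by
    rw [hfg x, add_sub_cancel_right, Finset.mul_sum]
    refine Finset.sum_congr rfl fun k _ => ?_
    rw [cutTaylorTerm, cutMonomial]
    push_cast
    ring
  rw [hT]
  have h := hcq (x j)
  simp only [Function.comp]
  linear_combination (ρ x * f x : ℂ) * h

theorem monomialOsc_add {n : ℕ} (m : Fin n → ℕ) (σ : Fin n → ℝ) {f g : (Fin n → ℝ) → ℂ}
    (hf : IsTestFunction f) (hg : IsTestFunction g) (R : ℝ) :
    monomialOsc m σ (fun x => f x + g x) R = monomialOsc m σ f R + monomialOsc m σ g R := by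
  simp only [monomialOsc, mul_add]
  exact integral_add (hf.mul_left (contDiff_monomialPhase m σ R)).integrable
    (hg.mul_left (contDiff_monomialPhase m σ R)).integrable

theorem monomialOsc_sum {n : ℕ} (m : Fin n → ℕ) (σ : Fin n → ℝ) {ι : Type*} (s : Finset ι)
    {f : ι → (Fin n → ℝ) → ℂ} (hf : ∀ i ∈ s, IsTestFunction (f i)) (R : ℝ) :
    monomialOsc m σ (fun x => ∑ i ∈ s, f i x) R = ∑ i ∈ s, monomialOsc m σ (f i) R := by
  simp only [monomialOsc, Finset.mul_sum]
  exact integral_finsetSum s fun i hi =>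
    ((hf i hi).mul_left (contDiff_monomialPhase m σ R)).integrable

theorem isBigO_monomialOsc_sub_sum_cutTaylorTerm {n : ℕ} {m : Fin n → ℕ} (hm : ∀ j, 1 ≤ m j)
    {σ : Fin n → ℝ} (hσ : ∀ j, σ j = 1 ∨ σ j = -1) (j : Fin n) (L : ℕ)
    {f : (Fin n → ℝ) → ℂ} (hf : IsTestFunction f) :
    (fun R : ℝ => monomialOsc m σ f R -
      ∑ k ∈ Finset.range (m j * L), monomialOsc m σ (cutTaylorTerm m j k f) R)
      =O[atTop] fun R : ℝ => (R ^ L)⁻¹ := by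
  obtain ⟨g, hg, hfg⟩ := exists_cutTaylor_remainder hm j (m j * L) hf
  obtain ⟨C, hC⟩ := exists_norm_monomialOsc_le hm hσ j L g hg
  refine Asymptotics.IsBigO.of_bound C ?_
  filter_upwards [eventually_ge_atTop 1] with R hR
  have hR0 : 0 < R ^ L := by positivity
  have hT : ∀ k ∈ Finset.range (m j * L), IsTestFunction (cutTaylorTerm m j k f) :=
    fun k _ => hf.cutTaylorTerm hm j k
  rw [← monomialOsc_sum m σ _ hT, funext hfg, monomialOsc_add m σ (IsTestFunction.sum _ hT)
    (hg.mul_left ((contDiff_coord j).pow _)), ← funext hfg, add_sub_cancel_left,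
    Real.norm_of_nonneg (by positivity), ← div_eq_mul_inv, le_div_iff₀ hR0, mul_comm]
  exact hC R hR

/-- The successive application of cut-off Taylor terms of orders `α j` in the coordinates of a
list. -/
noncomputable def cutTaylorMonomial {n : ℕ} (m : Fin n → ℕ) (l : List (Fin n)) (α : Fin n → ℕ)
    (f : (Fin n → ℝ) → ℂ) : (Fin n → ℝ) → ℂ :=
  l.foldr (fun j F => cutTaylorTerm m j (α j) F) f

theorem IsTestFunction.cutTaylorMonomial {n : ℕ} {m : Fin n → ℕ} (hm : ∀ j, 1 ≤ m j)
    (l : List (Fin n)) (α : Fin n → ℕ) {f : (Fin n → ℝ) → ℂ} (hf : IsTestFunction f) :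
    IsTestFunction (cutTaylorMonomial m l α f) := by
  induction l with
  | nil => exact hf
  | cons j l ih => exact ih.cutTaylorTerm hm j (α j)

theorem cutTaylorMonomial_congr {n : ℕ} (m : Fin n → ℕ) (l : List (Fin n)) {α β : Fin n → ℕ}
    (h : ∀ j ∈ l, α j = β j) (f : (Fin n → ℝ) → ℂ) :
    cutTaylorMonomial m l α f = cutTaylorMonomial m l β f := by
  induction l with
  | nil => rfl
  | cons j l ih =>
    have h1 := ih fun i hi => h i (List.mem_cons_of_mem j hi)
    simp only [cutTaylorMonomial, List.foldr_cons] at h1 ⊢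
    rw [h1, h j List.mem_cons_self]

theorem isBigO_monomialOsc_sub_sum_cutTaylorMonomial {n : ℕ} {m : Fin n → ℕ}
    (hm : ∀ j, 1 ≤ m j) {σ : Fin n → ℝ} (hσ : ∀ j, σ j = 1 ∨ σ j = -1) (L : ℕ)
    {f : (Fin n → ℝ) → ℂ} (hf : IsTestFunction f) (l : List (Fin n)) (hl : l.Nodup) :
    (fun R : ℝ => monomialOsc m σ f R -
      ∑ α ∈ Fintype.piFinset fun i => if i ∈ l then Finset.range (m i * L) else {0},
        monomialOsc m σ (cutTaylorMonomial m l α f) R)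
      =O[atTop] fun R : ℝ => (R ^ L)⁻¹ := by
  induction l with
  | nil => simp [cutTaylorMonomial, Asymptotics.isBigO_zero]
  | cons j l ih =>
    obtain ⟨hjl, hl⟩ := List.nodup_cons.1 hl
    set s := Fintype.piFinset fun i => if i ∈ l then Finset.range (m i * L) else {0} with hs
    have hsum : ∀ R, ∑ α ∈ Fintype.piFinset
          fun i => if i ∈ j :: l then Finset.range (m i * L) else {0},
          monomialOsc m σ (cutTaylorMonomial m (j :: l) α f) R =
        ∑ α ∈ s, ∑ k ∈ Finset.range (m j * L),
          monomialOsc m σ (cutTaylorTerm m j k (cutTaylorMonomial m l α f)) R := fun R => by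
      rw [← Finset.sum_product']
      refine Finset.sum_nbij' (fun β => (Function.update β j 0, β j))
        (fun p => Function.update p.1 j p.2) ?_ ?_ ?_ ?_ ?_
      · intro β hβ
        rw [Fintype.mem_piFinset] at hβ
        rw [Finset.mem_product, hs, Fintype.mem_piFinset]
        refine ⟨fun i => ?_, by simpa using hβ j⟩
        by_cases hij : i = j
        · subst hij; simp [hjl]
        · simpa [hij] using hβ i
      · intro p hp
        rw [Finset.mem_product, hs, Fintype.mem_piFinset] at hp
        rw [Fintype.mem_piFinset]
        intro i
        by_cases hij : i = j
        · subst hij; simpa using hp.2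
        · simpa [hij] using hp.1 i
      · intro β _
        simp
      · intro p hp
        rw [Finset.mem_product, hs, Fintype.mem_piFinset] at hp
        have h0 : p.1 j = 0 := by simpa [hjl] using hp.1 j
        ext1
        · simp [← h0]
        · simp
      · intro β _
        rw [cutTaylorMonomial_congr m l (α := Function.update β j 0) (β := β) fun i hi =>
          Function.update_of_ne (by rintro rfl; exact hjl hi) _ _]
        rfl
    simp only [hsum]
    refine ((ih hl).add (Asymptotics.IsBigO.fun_sum (s := s) fun α _ =>
      isBigO_monomialOsc_sub_sum_cutTaylorTerm hm hσ j L
        (hf.cutTaylorMonomial hm l α))).congr_left fun R => ?_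
    rw [Finset.sum_sub_distrib]
    ring

theorem iterate_pderiv_comp_mul {n : ℕ} (j : Fin n) {Z : (Fin n → ℝ) → Fin n → ℝ}
    (hZ : ∀ x t, Z (Function.update x j t) = Function.update (Z x) j t)
    {M : (Fin n → ℝ) → ℂ} (hM : ∀ x t, M (Function.update x j t) = M x)
    (D : (Fin n → ℝ) → ℂ) (k : ℕ) :
    (pderiv j)^[k] (fun x => D (Z x) * M x) = fun x => (pderiv j)^[k] D (Z x) * M x := by
  have hZj : ∀ x, Z x j = x j := fun x => by
    have := hZ x (x j)
    rw [Function.update_eq_self] at this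
    rw [this, Function.update_self]
  induction k with
  | zero => rfl
  | succ k ih =>
    rw [Function.iterate_succ_apply', ih, Function.iterate_succ_apply']
    ext x
    simp only [pderiv, hZ, hM, hZj]
    exact deriv_mul_const_field _

theorem cutTaylorMonomial_apply {n : ℕ} (m : Fin n → ℕ) (l : List (Fin n)) (hl : l.Nodup)
    (α : Fin n → ℕ) (f : (Fin n → ℝ) → ℂ) (x : Fin n → ℝ) :
    cutTaylorMonomial m l α f x =
      (l.foldr (fun j G => (pderiv j)^[α j] ∘ G) id) f (fun i => if i ∈ l then 0 else x i) *
        ∏ j ∈ l.toFinset, (cutMonomial (m j) (α j) (x j) / ((α j).factorial : ℂ)) := by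
  induction l generalizing x with
  | nil => simp [cutTaylorMonomial]
  | cons j l ih =>
    obtain ⟨hjl, hl⟩ := List.nodup_cons.1 hl
    have h1 : cutTaylorMonomial m (j :: l) α f =
        cutTaylorTerm m j (α j) (cutTaylorMonomial m l α f) := rfl
    rw [h1, cutTaylorTerm, funext (ih hl), iterate_pderiv_comp_mul j
      (Z := fun (x : Fin n → ℝ) i => if i ∈ l then 0 else x i)
      (M := fun x => ∏ j ∈ l.toFinset, (cutMonomial (m j) (α j) (x j) / ((α j).factorial : ℂ)))]
    · have h2 : (fun i => if i ∈ l then 0 else Function.update x j 0 i) =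
          fun i => if i ∈ j :: l then 0 else x i := by
        ext i
        by_cases hij : i = j
        · subst hij; simp
        · simp [hij]
      have h3 : ∏ i ∈ l.toFinset,
          (cutMonomial (m i) (α i) (Function.update x j 0 i) / ((α i).factorial : ℂ)) =
          ∏ i ∈ l.toFinset, (cutMonomial (m i) (α i) (x i) / ((α i).factorial : ℂ)) := by
        refine Finset.prod_congr rfl fun i hi => ?_
        rw [Function.update_of_ne]
        rintro rfl
        exact hjl (List.mem_toFinset.1 hi)
      simp only [h2, h3]
      rw [List.toFinset_cons, Finset.prod_insert (by simpa using hjl), List.foldr_cons,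
        Function.comp_apply]
      ring
    · intro x t
      ext i
      by_cases hij : i = j
      · subst hij; simp [hjl]
      · simp [hij]
    · intro x t
      refine Finset.prod_congr rfl fun i hi => ?_
      rw [Function.update_of_ne]
      rintro rfl
      exact hjl (List.mem_toFinset.1 hi)

theorem cutTaylorMonomial_finRange {n : ℕ} (m : Fin n → ℕ) (α : Fin n → ℕ)
    (f : (Fin n → ℝ) → ℂ) (x : Fin n → ℝ) :
    cutTaylorMonomial m (List.finRange n) α f x =
      multiDeriv α f 0 / (∏ j, ((α j).factorial : ℂ)) * ∏ j, cutMonomial (m j) (α j) (x j) := by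
  have h0 : (fun _ : Fin n => (0 : ℝ)) = 0 := rfl
  rw [cutTaylorMonomial_apply m _ (List.nodup_finRange n), multiDeriv]
  simp only [List.mem_finRange, if_true, List.toFinset_finRange, Finset.prod_div_distrib, h0]
  ring

theorem monomialOsc_const_mul_prod {n : ℕ} (m : Fin n → ℕ) (σ : Fin n → ℝ) (c : ℂ)
    (u : Fin n → ℝ → ℂ) (R : ℝ) :
    monomialOsc m σ (fun x => c * ∏ j, u j (x j)) R =
      c * ∏ j, ∫ t : ℝ, Complex.exp (Complex.I * R * ((σ j * t ^ m j : ℝ) : ℂ)) * u j t := by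
  rw [← integral_fintype_prod_volume_eq_prod (fun j (t : ℝ) =>
    Complex.exp (Complex.I * R * ((σ j * t ^ m j : ℝ) : ℂ)) * u j t), ← integral_const_mul,
    monomialOsc]
  congr 1; ext x
  rw [Complex.ofReal_sum, Finset.mul_sum, Complex.exp_sum, Finset.prod_mul_distrib]
  ring

theorem isBigO_prod_sub_prod {ι : Type*} (s : Finset ι) {f g : ι → ℝ → ℂ} {h : ℝ → ℝ}
    (hh : h =O[atTop] fun _ => (1 : ℝ)) (hg : ∀ i ∈ s, g i =O[atTop] fun _ => (1 : ℝ))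
    (hfg : ∀ i ∈ s, (fun R => f i R - g i R) =O[atTop] h) :
    (fun R => ∏ i ∈ s, f i R - ∏ i ∈ s, g i R) =O[atTop] h := by
  classical
  induction s using Finset.induction_on with
  | empty => simp [Asymptotics.isBigO_zero]
  | insert i s hi ih =>
    simp only [Finset.prod_insert hi]
    have h1 := ih (fun k hk => hg k (Finset.mem_insert_of_mem hk))
      fun k hk => hfg k (Finset.mem_insert_of_mem hk)
    have h2 := hfg i (Finset.mem_insert_self i s)
    have hgi := hg i (Finset.mem_insert_self i s)
    have hfi : f i =O[atTop] fun _ => (1 : ℝ) :=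
      ((h2.trans hh).add hgi).congr_left fun R => by ring
    have hgs : (fun R => ∏ k ∈ s, g k R) =O[atTop] fun _ => (1 : ℝ) := by
      simpa using Asymptotics.IsBigO.finsetProd (s := s) (g := fun _ _ => (1 : ℝ))
        fun k hk => hg k (Finset.mem_insert_of_mem hk)
    have h3 := hfi.mul h1
    have h4 := h2.mul hgs
    simp only [one_mul, mul_one] at h3 h4
    exact (h3.add h4).congr_left fun R => by ring

theorem isBigO_monomialOsc_cutTaylorMonomial_sub {n : ℕ} {m : Fin n → ℕ}
    (hm : ∀ j, 1 ≤ m j) {σ : Fin n → ℝ} (hσ : ∀ j, σ j = 1 ∨ σ j = -1) (L : ℕ)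
    (f : (Fin n → ℝ) → ℂ) (α : Fin n → ℕ) :
    (fun R : ℝ => monomialOsc m σ (cutTaylorMonomial m (List.finRange n) α f) R -
      (∏ j, monomialCoeff (m j) (α j) (σ j)) *
        (multiDeriv α f 0 / (∏ j, ((α j).factorial : ℂ))) *
        ((R ^ (-∑ j, ((α j : ℝ) + 1) / (m j : ℝ)) : ℝ) : ℂ))
      =O[atTop] fun R : ℝ => (R ^ L)⁻¹ := by
  have hone : (fun R : ℝ => (R ^ L)⁻¹) =O[atTop] fun _ => (1 : ℝ) := by
    refine Asymptotics.IsBigO.of_bound 1 ?_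
    filter_upwards [eventually_ge_atTop 1] with R hR
    rw [Real.norm_of_nonneg (by positivity)]
    simpa using inv_le_one_of_one_le₀ (one_le_pow₀ hR)
  have hprod := isBigO_prod_sub_prod (Finset.univ : Finset (Fin n))
    (f := fun j R => ∫ t : ℝ, Complex.exp (Complex.I * R * ((σ j * t ^ m j : ℝ) : ℂ)) *
      cutMonomial (m j) (α j) t)
    (g := fun j R => monomialCoeff (m j) (α j) (σ j) *
      ((R ^ (-(((α j : ℝ) + 1) / m j)) : ℝ) : ℂ)) hone
    (fun j _ => by
      refine Asymptotics.IsBigO.of_bound ‖monomialCoeff (m j) (α j) (σ j)‖ ?_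
      filter_upwards [eventually_ge_atTop 1] with R hR
      rw [norm_mul, norm_one, Complex.norm_real, Real.norm_of_nonneg (by positivity)]
      gcongr
      exact Real.rpow_le_one_of_one_le_of_nonpos hR (neg_nonpos.2 (by positivity)))
    (fun j _ => by
      obtain ⟨C, hC⟩ := exists_norm_integral_exp_mul_cutMonomial_sub_le (hm j) (α j) (hσ j) L
      refine Asymptotics.IsBigO.of_bound C ?_
      filter_upwards [eventually_ge_atTop 1] with R hR
      have hR0 : 0 < R ^ L := by positivity
      rw [Real.norm_of_nonneg (by positivity), ← div_eq_mul_inv, le_div_iff₀ hR0, mul_comm]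
      exact hC R hR)
  refine (hprod.const_mul_left (multiDeriv α f 0 / (∏ j, ((α j).factorial : ℂ)))).congr' ?_
    EventuallyEq.rfl
  filter_upwards [eventually_gt_atTop 0] with R hR
  rw [funext (cutTaylorMonomial_finRange m α f), monomialOsc_const_mul_prod,
    Finset.prod_mul_distrib, ← Complex.ofReal_prod, ← Finset.sum_neg_distrib,
    Real.rpow_sum_of_pos hR]
  ring

/-- **Multivariable asymptotic expansion over `ℝⁿ` for monomial phases
`Σ_j ±_j x_j^{m_j}`** (signs encoded by `sgn j = ±1`): for every `N ≥ 1`,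
`∫_{ℝⁿ} e^{iλ Σ_j ±_j x_j^{m_j}} a(x) dx
  = Σ_{α ∈ Ω_m^N} ∏_j c^{±_j}_{m_j,α_j} · ∂^α a(0)/α! · λ^{-Σ_j (α_j+1)/m_j}
    + O(λ^{-(N+1)/max_j m_j})` as `λ → ∞`, where
`Ω_m^N = {α : Σ_j (α_j+1)/m_j < (N+1)/max_j m_j}` and
`c^{±_j}_{m_j,α_j} = m_j⁻¹ [e^{±_j iπ(α_j+1)/(2m_j)}
  + (-1)^{α_j} e^{±_j (-1)^{m_j} iπ(α_j+1)/(2m_j)}] Γ((α_j+1)/m_j)`. -/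
theorem multivariable_expansion_monomials (n : ℕ) (hn : 1 ≤ n)
    (m : Fin n → ℕ) (hm : ∀ j, 1 ≤ m j)
    (sgn : Fin n → ℝ) (hsgn : ∀ j, sgn j = 1 ∨ sgn j = -1)
    (a : (Fin n → ℝ) → ℂ) (ha : ContDiff ℝ (⊤ : ℕ∞) a) (hsupp : HasCompactSupport a)
    (N : ℕ) (hN : 1 ≤ N) :
    (fun lam : ℝ =>
      (∫ x : Fin n → ℝ,
        Complex.exp (Complex.I * lam *
          ((∑ j, sgn j * x j ^ m j : ℝ) : ℂ)) * a x) -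
      ∑' α : {α : Fin n → ℕ //
          ∑ j, ((α j : ℝ) + 1) / (m j : ℝ) < ((N : ℝ) + 1) / ⨆ j, (m j : ℝ)},
        (∏ j, ((m j : ℂ)⁻¹ *
            (Complex.exp (sgn j * Complex.I *
                ((Real.pi * ((α.1 j : ℝ) + 1) / (2 * m j) : ℝ) : ℂ)) +
              (-1 : ℂ) ^ (α.1 j) *
                Complex.exp ((sgn j * (-1) ^ m j : ℝ) * Complex.I *
                  ((Real.pi * ((α.1 j : ℝ) + 1) / (2 * m j) : ℝ) : ℂ))) *
            Complex.Gamma ((((α.1 j : ℝ) + 1) / (m j : ℝ) : ℝ) : ℂ))) *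
          (multiDeriv α.1 a 0 / (∏ j, (Nat.factorial (α.1 j) : ℂ))) *
          ((lam ^ (-∑ j, ((α.1 j : ℝ) + 1) / (m j : ℝ)) : ℝ) : ℂ))
      =O[atTop] fun lam : ℝ => lam ^ (-((N : ℝ) + 1) / ⨆ j, (m j : ℝ)) := by
  set M : ℝ := ⨆ j, (m j : ℝ) with hMdef
  have hbdd : BddAbove (range fun j => (m j : ℝ)) := (finite_range _).bddAbove
  have hM1 : 1 ≤ M := by
    have h1 : (1 : ℝ) ≤ m ⟨0, hn⟩ := by exact_mod_cast hm _
    exact h1.trans (le_ciSup hbdd _)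
  have hM0 : 0 < M := one_pos.trans_le hM1
  set L : ℕ := N + 1 with hL
  have hLM : ((N : ℝ) + 1) / M ≤ L := by
    rw [hL, Nat.cast_add_one]
    exact div_le_self (by positivity) hM1
  have hpow : (fun R : ℝ => (R ^ L)⁻¹) =O[atTop] fun R : ℝ => R ^ (-((N : ℝ) + 1) / M) := by
    refine Asymptotics.IsBigO.of_bound 1 ?_
    filter_upwards [eventually_ge_atTop 1] with R hR
    have hR0 : 0 < R := one_pos.trans_le hR
    rw [Real.norm_of_nonneg (by positivity), Real.norm_of_nonneg (by positivity), one_mul,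
      ← Real.rpow_natCast, ← Real.rpow_neg hR0.le]
    refine Real.rpow_le_rpow_of_exponent_le hR ?_
    rw [neg_div]
    exact neg_le_neg hLM
  set box : Finset (Fin n → ℕ) := Fintype.piFinset fun i =>
    if i ∈ List.finRange n then Finset.range (m i * L) else {0} with hbox
  set Ω : Set (Fin n → ℕ) :=
    {α | ∑ j, ((α j : ℝ) + 1) / (m j : ℝ) < ((N : ℝ) + 1) / M} with hΩ
  have hΩbox : ∀ α ∈ Ω, α ∈ box := fun α hα => by
    rw [hbox, Fintype.mem_piFinset]
    intro i
    have hmi : (0 : ℝ) < m i := by exact_mod_cast hm i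
    have h1 : ((α i : ℝ) + 1) / (m i : ℝ) ≤ ∑ j, ((α j : ℝ) + 1) / (m j : ℝ) :=
      Finset.single_le_sum (f := fun j => ((α j : ℝ) + 1) / (m j : ℝ))
        (fun j _ => by positivity) (Finset.mem_univ i)
    have h2 : ((α i : ℝ) + 1) / (m i : ℝ) < L := (h1.trans_lt hα).trans_le hLM
    rw [div_lt_iff₀ hmi] at h2
    have h3 : α i + 1 < L * m i := by exact_mod_cast h2
    simp only [List.mem_finRange, if_true, Finset.mem_range]
    rw [mul_comm]
    omega
  set T : (Fin n → ℕ) → ℝ → ℂ := fun α R =>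
    (∏ j, monomialCoeff (m j) (α j) (sgn j)) *
      (multiDeriv α a 0 / (∏ j, ((α j).factorial : ℂ))) *
      ((R ^ (-∑ j, ((α j : ℝ) + 1) / (m j : ℝ)) : ℝ) : ℂ) with hT
  have htsum : ∀ R, ∑' α : Ω, T α R = ∑ α ∈ box, Ω.indicator (fun α => T α R) α := fun R => by
    rw [tsum_subtype Ω fun α => T α R]
    exact tsum_eq_sum fun α hα => indicator_of_notMem (fun h => hα (hΩbox α h)) _
  have hdrop : ∀ α ∈ box, (fun R => T α R - Ω.indicator (fun α => T α R) α)
      =O[atTop] fun R : ℝ => R ^ (-((N : ℝ) + 1) / M) := fun α _ => by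
    by_cases hα : α ∈ Ω
    · simp [indicator_of_mem hα, Asymptotics.isBigO_zero]
    · simp only [indicator_of_notMem hα, sub_zero]
      refine Asymptotics.IsBigO.const_mul_left (Asymptotics.IsBigO.of_bound 1 ?_) _
      filter_upwards [eventually_ge_atTop 1] with R hR
      have hR0 : 0 < R := one_pos.trans_le hR
      rw [Complex.norm_real, Real.norm_of_nonneg (by positivity),
        Real.norm_of_nonneg (by positivity), one_mul, neg_div]
      exact Real.rpow_le_rpow_of_exponent_le hR (neg_le_neg (not_lt.1 hα))
  have hfinal := (((isBigO_monomialOsc_sub_sum_cutTaylorMonomial hm hsgn L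
    (f := a) ⟨ha, hsupp⟩ (List.finRange n) (List.nodup_finRange n)).trans hpow).add
    (Asymptotics.IsBigO.fun_sum (s := box) fun α _ =>
      (isBigO_monomialOsc_cutTaylorMonomial_sub hm hsgn L a α).trans hpow)).add
    (Asymptotics.IsBigO.fun_sum (s := box) hdrop)
  refine hfinal.congr_left fun R => ?_
  change _ = monomialOsc m sgn a R - ∑' α : Ω, T α R
  rw [htsum, Finset.sum_sub_distrib, Finset.sum_sub_distrib]
  ring
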